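/- arXiv:1201.6174 — 4 statements merged into one kernel-verified Lean document; each statement's English description precedes it below -/
import Mathlib

section
/- Let n ≥ 2, let r ∈ {1,…,n}, let P₁ and P₂ be partitions of {1,…,n} into r blocks in which each block has size at most ⌈n/r⌉, and let C be an n×n Boolean matrix with at most L non-zero entries. Fix i, j with C[i,j] = 1 and fix a₀, b₀ ∈ {1,…,n}. Let σ and τ be two permutations of {1,…,n} chosen independently and uniformly at random, conditioned on σ(i) = a₀ and τ(j) = b₀. Then for any a ≠ a₀ and b ≠ b₀, the probability that the permuted matrix has a non-zero entry at position (a,b), i.e. that C[σ⁻¹(a), τ⁻¹(b)] = 1, is at most L/(n−1)². -/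
open Finset in
/-- Among the permutations sending `i` to `x`, at most a fraction `1 / (n - 1)` also send `k`
to a given `y ≠ x`. -/
theorem card_pred_mul_card_perm_filter_le {α : Type*} [Fintype α] [DecidableEq α]
    {i x y : α} (hy : y ≠ x) (k : α) :
    (Fintype.card α - 1) * #{σ : Equiv.Perm α | σ i = x ∧ σ⁻¹ y = k} ≤
      #{σ : Equiv.Perm α | σ i = x} := by
  rcases eq_or_ne k i with rfl | hk
  · have h : #{σ : Equiv.Perm α | σ k = x ∧ σ⁻¹ y = k} = 0 := by
      rw [card_eq_zero, filter_eq_empty_iff]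
      rintro σ - ⟨h₁, h₂⟩
      rw [Equiv.Perm.inv_eq_iff_eq] at h₂
      exact hy (h₂.trans h₁)
    rw [h, mul_zero]
    exact Nat.zero_le _
  have hmaps : Set.MapsTo (fun σ : Equiv.Perm α => σ⁻¹ y)
      ({σ : Equiv.Perm α | σ i = x} : Finset _) (univ.erase i : Finset α) := by
    intro σ hσ
    simp only [coe_filter, mem_univ, true_and, Set.mem_ofPred_eq] at hσ
    simp only [coe_erase, coe_univ, Set.mem_sdiff, Set.mem_univ, Set.mem_singleton_iff, true_and,
      Equiv.Perm.inv_eq_iff_eq, hσ]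
    exact hy
  rw [card_eq_sum_card_fiberwise hmaps, ← card_univ, ← card_erase_of_mem (mem_univ i),
    ← smul_eq_mul]
  refine card_nsmul_le_sum _ _ _ fun k' hk' => ?_
  rw [filter_filter]
  refine card_le_card_of_injOn (· * Equiv.swap k k') ?_ (mul_left_injective _).injOn
  intro σ hσ
  simp only [coe_filter, mem_univ, true_and, Set.mem_ofPred_eq, Equiv.Perm.inv_eq_iff_eq] at hσ ⊢
  simpa [Equiv.swap_apply_of_ne_of_ne hk.symm (ne_of_mem_erase hk').symm] using hσ


/-- Let `n ≥ 2`, `r ∈ {1,…,n}`, let `P₁` and `P₂` be partitions of `{1,…,n}`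
into `r` blocks each of size at most `⌈n/r⌉`, and let `C` be an `n × n` Boolean matrix
with at most `L` non-zero entries.  Fix `i, j` with `C[i,j] = 1` and `a₀, b₀`.  For a
uniformly random independent pair of permutations `(σ, τ)` conditioned on `σ i = a₀` and
`τ j = b₀`, for any `a ≠ a₀` and `b ≠ b₀`, the probability that
`C[σ⁻¹ a, τ⁻¹ b] = 1` is at most `L/(n-1)²`.  The conditional probability is expressed
as a ratio of counts of pairs of permutations. -/
theorem stmt_2 (n : ℕ) (hn : 2 ≤ n) (r : ℕ) (hr : 1 ≤ r) (hrn : r ≤ n)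
    (P₁ P₂ : Fin n → Fin r)
    (hP₁ : ∀ t : Fin r, (Finset.univ.filter (fun x => P₁ x = t)).card ≤ ⌈(n : ℝ) / r⌉₊)
    (hP₂ : ∀ t : Fin r, (Finset.univ.filter (fun x => P₂ x = t)).card ≤ ⌈(n : ℝ) / r⌉₊)
    (L : ℕ) (C : Matrix (Fin n) (Fin n) Bool)
    (hC : (Finset.univ.filter (fun p : Fin n × Fin n => C p.1 p.2 = true)).card ≤ L)
    (i j a₀ b₀ : Fin n) (hij : C i j = true)
    (a b : Fin n) (haa : a ≠ a₀) (hbb : b ≠ b₀) :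
    ((Finset.univ.filter
        (fun p : Equiv.Perm (Fin n) × Equiv.Perm (Fin n) =>
          (p.1 i = a₀ ∧ p.2 j = b₀) ∧ C (p.1⁻¹ a) (p.2⁻¹ b) = true)).card : ℝ) /
      ((Finset.univ.filter
        (fun p : Equiv.Perm (Fin n) × Equiv.Perm (Fin n) =>
          p.1 i = a₀ ∧ p.2 j = b₀)).card : ℝ)
      ≤ (L : ℝ) / ((n : ℝ) - 1) ^ 2 := by
  have hn0 : (0 : ℝ) < (n : ℝ) - 1 := by
    have : (2 : ℝ) ≤ n := by exact_mod_cast hn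
    linarith
  have hden : Finset.univ.filter (fun p : Equiv.Perm (Fin n) × Equiv.Perm (Fin n) =>
      p.1 i = a₀ ∧ p.2 j = b₀) =
      (Finset.univ.filter fun σ : Equiv.Perm (Fin n) => σ i = a₀) ×ˢ
        (Finset.univ.filter fun τ : Equiv.Perm (Fin n) => τ j = b₀) := by
    ext p
    simp
  refine div_le_of_le_mul₀ (by positivity) (by positivity) ?_
  rw [div_mul_eq_mul_div, le_div_iff₀ (by positivity), hden, Finset.card_product,
    ← Nat.cast_pred (by omega : 0 < n)]
  norm_cast
  have hmaps : Set.MapsTo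
      (fun p : Equiv.Perm (Fin n) × Equiv.Perm (Fin n) => (p.1⁻¹ a, p.2⁻¹ b))
      (Finset.univ.filter (fun p : Equiv.Perm (Fin n) × Equiv.Perm (Fin n) =>
        (p.1 i = a₀ ∧ p.2 j = b₀) ∧ C (p.1⁻¹ a) (p.2⁻¹ b) = true) : Finset _)
      (Finset.univ.filter (fun p : Fin n × Fin n => C p.1 p.2 = true) : Finset _) := by
    intro p hp
    simpa using (Finset.mem_filter.mp hp).2.2
  rw [Finset.card_eq_sum_card_fiberwise hmaps, Finset.sum_mul]
  refine (Finset.sum_le_card_nsmul _ _ _ fun q _ => ?_).trans (Nat.mul_le_mul_right _ hC)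
  have hσ := card_pred_mul_card_perm_filter_le (i := i) haa q.1
  have hτ := card_pred_mul_card_perm_filter_le (i := j) hbb q.2
  rw [Fintype.card_fin] at hσ hτ
  refine le_trans ?_ (Nat.mul_le_mul hσ hτ)
  rw [mul_mul_mul_comm, ← Finset.card_product, ← sq, mul_comm]
  refine Nat.mul_le_mul_left _ (Finset.card_le_card fun p hp => ?_)
  simp only [Finset.mem_filter, Finset.mem_univ, true_and, Finset.mem_product, Prod.ext_iff]
    at hp ⊢
  exact ⟨⟨hp.1.1.1, hp.2.1⟩, hp.1.1.2, hp.2.2⟩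
end

section
/- Let n ≥ 2, let r ∈ {1,…,n}, let P₁ and P₂ be partitions of {1,…,n} into r blocks in which each block has size at most ⌈n/r⌉, and let C be an n×n Boolean matrix with at most L non-zero entries. Fix i, j with C[i,j] = 1 and fix a₀, b₀ ∈ {1,…,n}. Let σ and τ be two permutations of {1,…,n} chosen independently and uniformly at random, conditioned on σ(i) = a₀ and τ(j) = b₀. Let Y be the number of positions (a,b) in the subarray determined by the block of P₁ containing a₀ and the block of P₂ containing b₀ such that C[σ⁻¹(a), τ⁻¹(b)] = 1. Then the expectation of Y satisfies E[Y] ≤ L⌈n/r⌉²/(n−1)² + 2⌈n/r⌉ − 1. -/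
open Finset in
/-- Among the permutations sending `i` to `a₀`, a given element `x` is sent to a given `a ≠ a₀`
by at most a fraction `1 / (|α| - 1)` of them. -/
lemma card_perm_apply_eq_and_apply_eq_mul_le {α : Type*} [Fintype α] [DecidableEq α]
    {a₀ a : α} (i x : α) (ha : a ≠ a₀) :
    (Fintype.card α - 1) * #{s : Equiv.Perm α | s i = a₀ ∧ s x = a} ≤
      #{s : Equiv.Perm α | s i = a₀} := by
  have key : ∀ b ∈ univ.erase a₀, #{s : Equiv.Perm α | s i = a₀ ∧ s x = a} ≤
      #{s ∈ ({s : Equiv.Perm α | s i = a₀} : Finset (Equiv.Perm α)) | s x = b} := by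
    intro b hb
    have hb : b ≠ a₀ := ne_of_mem_erase hb
    refine card_le_card_of_injOn (fun s => Equiv.swap a b * s) ?_ (mul_right_injective _).injOn
    intro s hs
    simp only [coe_filter, mem_univ, true_and, Set.mem_ofPred_eq, mem_filter] at hs ⊢
    simp [hs.1, hs.2, Equiv.swap_apply_of_ne_of_ne ha.symm hb.symm]
  calc (Fintype.card α - 1) * #{s : Equiv.Perm α | s i = a₀ ∧ s x = a}
      = ∑ _b ∈ univ.erase a₀, #{s : Equiv.Perm α | s i = a₀ ∧ s x = a} := by
        simp [card_erase_of_mem]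
    _ ≤ ∑ b ∈ univ.erase a₀,
          #{s ∈ ({s : Equiv.Perm α | s i = a₀} : Finset (Equiv.Perm α)) | s x = b} :=
        sum_le_sum key
    _ ≤ ∑ b, #{s ∈ ({s : Equiv.Perm α | s i = a₀} : Finset (Equiv.Perm α)) | s x = b} :=
        sum_le_sum_of_subset (erase_subset _ _)
    _ = #{s : Equiv.Perm α | s i = a₀} :=
        (card_eq_sum_card_fiberwise (fun _ _ => mem_univ _)).symm

open Finset in
/-- The cross through `(a₀, b₀)` in `R ×ˢ S` has at most `|R| + |S| - 1` elements. -/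
lemma card_filter_product_cross_add_one_le {α β : Type*} [DecidableEq α] [DecidableEq β]
    {R : Finset α} {S : Finset β} {a₀ : α} {b₀ : β} (ha : a₀ ∈ R) (hb : b₀ ∈ S) :
    #{p ∈ R ×ˢ S | p.1 = a₀ ∨ p.2 = b₀} + 1 ≤ #R + #S := by
  have hsub : {p ∈ R ×ˢ S | p.1 = a₀ ∨ p.2 = b₀} ⊆ R ×ˢ {b₀} ∪ {a₀} ×ˢ S := by
    intro p hp
    simp only [mem_filter, mem_product, mem_union, mem_singleton] at hp ⊢
    tauto
  have hinter : 1 ≤ #(R ×ˢ {b₀} ∩ {a₀} ×ˢ S) :=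
    card_pos.mpr ⟨(a₀, b₀), by simp [ha, hb]⟩
  have h := card_union_add_card_inter (R ×ˢ {b₀}) ({a₀} ×ˢ S)
  simp only [card_product, card_singleton, mul_one, one_mul] at h
  have := card_le_card hsub
  omega

open Finset in
/-- Summing over the pairs of permutations with `s i = a₀` and `t j = b₀` the number of points
of `T` carried to a fixed `(a, b)` with `a ≠ a₀` and `b ≠ b₀`. -/
lemma sq_mul_sum_card_filter_inv_mem_le {α : Type*} [Fintype α] [DecidableEq α]
    (T : Finset (α × α)) (i j : α) {a₀ b₀ a b : α} (ha : a ≠ a₀) (hb : b ≠ b₀) :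
    (Fintype.card α - 1) ^ 2 *
      #{p : Equiv.Perm α × Equiv.Perm α |
        (p.1 i = a₀ ∧ p.2 j = b₀) ∧ (p.1⁻¹ a, p.2⁻¹ b) ∈ T} ≤
      #T * #{p : Equiv.Perm α × Equiv.Perm α | p.1 i = a₀ ∧ p.2 j = b₀} := by
  have hprod : #{p : Equiv.Perm α × Equiv.Perm α | p.1 i = a₀ ∧ p.2 j = b₀} =
      #{s : Equiv.Perm α | s i = a₀} * #{t : Equiv.Perm α | t j = b₀} := by
    rw [← card_product]
    congr 1
    ext p
    simp
  rw [card_eq_sum_card_fiberwise (f := fun p => (p.1⁻¹ a, p.2⁻¹ b)) (t := T)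
    (fun p hp => by simpa using (mem_filter.mp hp).2.2), mul_sum, ← smul_eq_mul (#T)]
  refine sum_le_card_nsmul _ _ _ fun q _ => ?_
  have hfiber : #{p ∈ ({p : Equiv.Perm α × Equiv.Perm α |
        (p.1 i = a₀ ∧ p.2 j = b₀) ∧ (p.1⁻¹ a, p.2⁻¹ b) ∈ T} :
          Finset (Equiv.Perm α × Equiv.Perm α)) | (p.1⁻¹ a, p.2⁻¹ b) = q} ≤
      #{s : Equiv.Perm α | s i = a₀ ∧ s q.1 = a} *
        #{t : Equiv.Perm α | t j = b₀ ∧ t q.2 = b} := by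
    rw [← card_product]
    refine card_le_card fun p hp => ?_
    simp only [mem_filter, mem_univ, true_and, mem_product] at hp ⊢
    obtain ⟨⟨⟨h1, h2⟩, -⟩, rfl⟩ := hp
    simp [h1, h2]
  calc _ ≤ (Fintype.card α - 1) ^ 2 * _ := Nat.mul_le_mul_left _ hfiber
    _ = ((Fintype.card α - 1) * #{s : Equiv.Perm α | s i = a₀ ∧ s q.1 = a}) *
        ((Fintype.card α - 1) * #{t : Equiv.Perm α | t j = b₀ ∧ t q.2 = b}) := by ring
    _ ≤ _ := by
      rw [hprod]
      exact Nat.mul_le_mul (card_perm_apply_eq_and_apply_eq_mul_le i q.1 ha)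
        (card_perm_apply_eq_and_apply_eq_mul_le j q.2 hb)


/-- With `n, r, P₁, P₂, C, L, i, j, a₀, b₀` as in Statement 2, let `Y(σ,τ)`
be the number of positions `(a,b)` in the subarray determined by the block of `P₁`
containing `a₀` and the block of `P₂` containing `b₀` with `C[σ⁻¹ a, τ⁻¹ b] = 1`.
Then for a uniformly random independent pair `(σ, τ)` conditioned on `σ i = a₀` and
`τ j = b₀`, the expectation of `Y` (expressed as the average of `Y` over the
conditioning event) satisfies `E[Y] ≤ L⌈n/r⌉²/(n-1)² + 2⌈n/r⌉ - 1`. -/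
theorem stmt_3 (n : ℕ) (hn : 2 ≤ n) (r : ℕ) (hr : 1 ≤ r) (hrn : r ≤ n)
    (P₁ P₂ : Fin n → Fin r)
    (hP₁ : ∀ t : Fin r, (Finset.univ.filter (fun x => P₁ x = t)).card ≤ ⌈(n : ℝ) / r⌉₊)
    (hP₂ : ∀ t : Fin r, (Finset.univ.filter (fun x => P₂ x = t)).card ≤ ⌈(n : ℝ) / r⌉₊)
    (L : ℕ) (C : Matrix (Fin n) (Fin n) Bool)
    (hC : (Finset.univ.filter (fun p : Fin n × Fin n => C p.1 p.2 = true)).card ≤ L)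
    (i j a₀ b₀ : Fin n) (hij : C i j = true)
    (Y : Equiv.Perm (Fin n) × Equiv.Perm (Fin n) → ℕ)
    (hY : ∀ p : Equiv.Perm (Fin n) × Equiv.Perm (Fin n),
      Y p = (Finset.univ.filter
        (fun ab : Fin n × Fin n => P₁ ab.1 = P₁ a₀ ∧ P₂ ab.2 = P₂ b₀ ∧
          C (p.1⁻¹ ab.1) (p.2⁻¹ ab.2) = true)).card) :
    (∑ p ∈ Finset.univ.filter
        (fun p : Equiv.Perm (Fin n) × Equiv.Perm (Fin n) =>
          p.1 i = a₀ ∧ p.2 j = b₀), (Y p : ℝ)) /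
      ((Finset.univ.filter
        (fun p : Equiv.Perm (Fin n) × Equiv.Perm (Fin n) =>
          p.1 i = a₀ ∧ p.2 j = b₀)).card : ℝ)
      ≤ (L : ℝ) * (⌈(n : ℝ) / r⌉₊ : ℝ) ^ 2 / ((n : ℝ) - 1) ^ 2
        + 2 * (⌈(n : ℝ) / r⌉₊ : ℝ) - 1 := by

  set K := ⌈(n : ℝ) / r⌉₊
  set F := Finset.univ.filter (fun p : Equiv.Perm (Fin n) × Equiv.Perm (Fin n) =>
    p.1 i = a₀ ∧ p.2 j = b₀) with hF
  set R := Finset.univ.filter (fun x => P₁ x = P₁ a₀) with hR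
  set S := Finset.univ.filter (fun x => P₂ x = P₂ b₀) with hS
  set T := Finset.univ.filter (fun p : Fin n × Fin n => C p.1 p.2 = true) with hT
  have hRK : R.card ≤ K := hP₁ (P₁ a₀)
  have hSK : S.card ≤ K := hP₂ (P₂ b₀)
  have ha₀ : a₀ ∈ R := by simp [hR]
  have hb₀ : b₀ ∈ S := by simp [hS]
  have hn1 : (0 : ℝ) < (n : ℝ) - 1 := by
    have : (2 : ℝ) ≤ n := by exact_mod_cast hn
    linarith
  have hK : (1 : ℝ) ≤ K := by
    exact_mod_cast (Finset.card_pos.mpr ⟨a₀, ha₀⟩).trans_le hRK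
  set A := (R ×ˢ S).filter (fun ab => ab.1 = a₀ ∨ ab.2 = b₀)
  set B := (R ×ˢ S).filter (fun ab => ¬ (ab.1 = a₀ ∨ ab.2 = b₀))
  have hA : (A.card : ℝ) ≤ 2 * K - 1 := by
    have h : A.card + 1 ≤ R.card + S.card := card_filter_product_cross_add_one_le ha₀ hb₀
    have h' : A.card + 1 ≤ 2 * K := by omega
    have : (A.card : ℝ) + 1 ≤ 2 * K := by exact_mod_cast h'
    linarith
  have hB : (B.card : ℝ) ≤ (K : ℝ) ^ 2 := by
    have h : B.card ≤ K ^ 2 := by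
      calc B.card ≤ (R ×ˢ S).card := Finset.card_filter_le _ _
        _ = R.card * S.card := Finset.card_product _ _
        _ ≤ K * K := Nat.mul_le_mul hRK hSK
        _ = K ^ 2 := (sq K).symm
    exact_mod_cast h
  have hYle : ∀ p, (Y p : ℝ) ≤ (A.card : ℝ) +
      ∑ ab ∈ B, if (p.1⁻¹ ab.1, p.2⁻¹ ab.2) ∈ T then (1 : ℝ) else 0 := by
    intro p
    have h : Y p ≤ A.card + (B.filter fun ab => (p.1⁻¹ ab.1, p.2⁻¹ ab.2) ∈ T).card := by
      rw [hY]
      refine (Finset.card_le_card ?_).trans (Finset.card_union_le _ _)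
      intro ab hab
      simp only [Finset.mem_filter, Finset.mem_univ, true_and, Finset.mem_union,
        Finset.mem_product, A, B, R, S, T] at hab ⊢
      tauto
    rw [Finset.sum_boole]
    exact_mod_cast h
  have hterm : ∀ ab ∈ B, (∑ p ∈ F, if (p.1⁻¹ ab.1, p.2⁻¹ ab.2) ∈ T then (1 : ℝ) else 0) ≤
      (L : ℝ) / ((n : ℝ) - 1) ^ 2 * F.card := by
    intro ab hab
    have hne := (Finset.mem_filter.mp hab).2
    push Not at hne
    have h := (sq_mul_sum_card_filter_inv_mem_le T i j hne.1 hne.2).trans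
      (Nat.mul_le_mul_right _ hC)
    rw [← Finset.filter_filter, ← hF, Fintype.card_fin] at h
    have h' : ((n : ℝ) - 1) ^ 2 *
        ((F.filter fun p => (p.1⁻¹ ab.1, p.2⁻¹ ab.2) ∈ T).card : ℝ) ≤ L * F.card := by
      have := (Nat.cast_le (α := ℝ)).mpr h
      rwa [Nat.cast_mul, Nat.cast_mul, Nat.cast_pow, Nat.cast_sub (by omega),
        Nat.cast_one] at this
    rw [Finset.sum_boole, div_mul_eq_mul_div, le_div_iff₀ (by positivity), mul_comm]
    exact h'
  refine div_le_of_le_mul₀ (by positivity) ?_ ?_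
  · have : (0 : ℝ) ≤ (L : ℝ) * (K : ℝ) ^ 2 / ((n : ℝ) - 1) ^ 2 := by positivity
    linarith
  calc ∑ p ∈ F, (Y p : ℝ)
      ≤ ∑ p ∈ F, ((A.card : ℝ) +
          ∑ ab ∈ B, if (p.1⁻¹ ab.1, p.2⁻¹ ab.2) ∈ T then (1 : ℝ) else 0) :=
        Finset.sum_le_sum fun p _ => hYle p
    _ = F.card * (A.card : ℝ) +
          ∑ ab ∈ B, ∑ p ∈ F, if (p.1⁻¹ ab.1, p.2⁻¹ ab.2) ∈ T then (1 : ℝ) else 0 := by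
        rw [Finset.sum_add_distrib, Finset.sum_const, nsmul_eq_mul, Finset.sum_comm]
    _ ≤ F.card * (2 * (K : ℝ) - 1) +
          (K : ℝ) ^ 2 * ((L : ℝ) / ((n : ℝ) - 1) ^ 2 * F.card) := by
        refine add_le_add (by gcongr) ((Finset.sum_le_card_nsmul _ _ _ hterm).trans ?_)
        rw [nsmul_eq_mul]
        gcongr
    _ = ((L : ℝ) * (K : ℝ) ^ 2 / ((n : ℝ) - 1) ^ 2 + 2 * (K : ℝ) - 1) * F.card := by
        ring
end

section
/- (Lemma 1 of the paper.) Let n ≥ 2, let r ∈ {1,…,n}, let P₁ and P₂ be partitions of {1,…,n} into r blocks in which each block has size at most ⌈n/r⌉, and let C be an n×n Boolean matrix with at most L non-zero entries. Fix i, j with C[i,j] = 1. Let σ and τ be two permutations of {1,…,n} chosen independently and uniformly at random. Then, with probability at least 9/10, the subarray of the permuted matrix C^{σ,τ} containing the position (σ(i), τ(j)) contains at most 10·( L⌈n/r⌉²/(n−1)² + 2⌈n/r⌉ − 1 ) non-zero entries; that is, the number of positions (a,b) in the subarray containing (σ(i), τ(j)) with C[σ⁻¹(a), τ⁻¹(b)]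 = 1 is at most this bound. -/
open Finset in
/-- For `k ≠ i`, a uniformly random permutation sends `k` into the block of the image of `i` with
probability at most `(s - 1) / (n - 1)`, when all blocks have at most `s` elements. -/
theorem card_perm_same_block_le {α β : Type*} [Fintype α] [DecidableEq α] [DecidableEq β]
    (P : α → β) (s : ℕ) (hP : ∀ t, #{x | P x = t} ≤ s) {i k : α} (hk : k ≠ i) :
    (Fintype.card α - 1) * #{σ : Equiv.Perm α | P (σ k) = P (σ i)} + Fintype.card (Equiv.Perm α)
      ≤ s * Fintype.card (Equiv.Perm α) := by
  have hconst : ∀ k' ∈ univ.erase i, #{σ : Equiv.Perm α | P (σ k') = P (σ i)}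
      = #{σ : Equiv.Perm α | P (σ k) = P (σ i)} := by
    intro k' hk'
    have hk'i : k' ≠ i := ne_of_mem_erase hk'
    refine card_equiv (Equiv.mulRight (Equiv.swap k k')) fun σ => ?_
    simp [Equiv.swap_apply_of_ne_of_ne hk.symm hk'i.symm]
  have hdouble : ∑ k', #{σ : Equiv.Perm α | P (σ k') = P (σ i)}
      = ∑ σ : Equiv.Perm α, #{k' | P (σ k') = P (σ i)} := by
    simp only [card_filter]
    exact sum_comm
  have hle : ∑ σ : Equiv.Perm α, #{k' | P (σ k') = P (σ i)}
      ≤ s * Fintype.card (Equiv.Perm α) := by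
    calc _ ≤ ∑ _σ : Equiv.Perm α, s := by
          refine sum_le_sum fun σ _ => le_trans (le_of_eq ?_) (hP (P (σ i)))
          exact card_equiv σ fun x => by simp
      _ = _ := by simp [mul_comm]
  rw [← hdouble, ← sum_erase_add _ _ (mem_univ i), sum_congr rfl hconst] at hle
  simpa using hle

open Finset in
theorem sum_prod_mul {α β : Type*} [Fintype α] [Fintype β] (f : α → ℝ) (h : β → ℝ) :
    ∑ e : α × β, f e.1 * h e.2 = (∑ a, f a) * ∑ b, h b := by
  rw [Fintype.sum_prod_type, sum_mul_sum]

open Finset in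
/-- Weights that are at most `1` on `i` (resp. `j`) and at most `x` elsewhere have a product sum over
a set of pairs controlled by the size of that set plus the contribution of row `i` and
column `j`. -/
theorem sum_mul_le_of_le_off_point {α : Type*} [Fintype α] [DecidableEq α] (S : Finset (α × α))
    (i j : α) (p q : α → ℝ) (x : ℝ) (hx : 0 ≤ x) (hq0 : ∀ l, 0 ≤ q l)
    (hpi : p i ≤ 1) (hqj : q j ≤ 1) (hp : ∀ k, k ≠ i → p k ≤ x) (hq : ∀ l, l ≠ j → q l ≤ x) :
    ∑ e ∈ S, p e.1 * q e.2 ≤ #S * x ^ 2 + 2 * (((Fintype.card α : ℝ) - 1) * x) + 1 := by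
  let g : α × α → ℝ := fun e =>
    (if e.1 = i then 1 else 0) * (if e.2 = j then 0 else x)
      + (if e.1 = i then 0 else x) * (if e.2 = j then 1 else 0)
      + (if e.1 = i then 1 else 0) * (if e.2 = j then 1 else 0)
  have hg0 : ∀ e, 0 ≤ g e := fun e => by
    simp only [g]
    split_ifs <;> simp [hx]
  have hpoint : ∀ e ∈ S, p e.1 * q e.2 ≤ x ^ 2 + g e := by
    rintro ⟨k, l⟩ -
    by_cases hk : k = i <;> by_cases hl : l = j <;> simp only [g, hk, hl, if_true, if_false]
    · nlinarith [hq0 j, mul_le_mul hpi hqj (hq0 j) zero_le_one]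
    · nlinarith [mul_le_mul hpi (hq l hl) (hq0 l) zero_le_one]
    · nlinarith [mul_le_mul (hp k hk) hqj (hq0 j) hx]
    · nlinarith [mul_le_mul (hp k hk) (hq l hl) (hq0 l) hx]
  have hoff : ∀ a : α, ∑ l, (if l = a then 0 else x) = ((Fintype.card α : ℝ) - 1) * x := by
    intro a
    have h : ∀ l : α, (if l = a then 0 else x) = x - if l = a then x else 0 := fun l => by
      split_ifs <;> simp
    simp only [h, sum_sub_distrib]
    simp [sub_mul]
  have hg : ∑ e, g e = 2 * (((Fintype.card α : ℝ) - 1) * x) + 1 := by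
    simp only [g, sum_add_distrib]
    rw [sum_prod_mul (fun k => if k = i then (1 : ℝ) else 0) (fun l => if l = j then 0 else x),
      sum_prod_mul (fun k => if k = i then 0 else x) (fun l => if l = j then (1 : ℝ) else 0),
      sum_prod_mul (fun k => if k = i then (1 : ℝ) else 0)
        (fun l => if l = j then (1 : ℝ) else 0), hoff, hoff]
    simp
    ring
  calc ∑ e ∈ S, p e.1 * q e.2 ≤ ∑ e ∈ S, (x ^ 2 + g e) := sum_le_sum hpoint
    _ = #S * x ^ 2 + ∑ e ∈ S, g e := by simp [sum_add_distrib]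
    _ ≤ #S * x ^ 2 + ∑ e, g e := by
      refine add_le_add_right ?_ _
      exact sum_le_sum_of_subset_of_nonneg (subset_univ S) fun e _ _ => hg0 e
    _ = _ := by rw [hg]; ring

open Finset in
/-- Markov's inequality for the uniform distribution on a finite type, in complementary form. -/
theorem one_sub_inv_le_card_filter_div {Ω : Type*} [Fintype Ω] [Nonempty Ω] (N : Ω → ℝ)
    (hN : ∀ ω, 0 ≤ N ω) {c B : ℝ} (hc : 0 < c) (hB : 0 < B)
    (hmean : ∑ ω, N ω ≤ B * Fintype.card Ω) [DecidablePred fun ω => N ω ≤ c * B] :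
    1 - c⁻¹ ≤ (#{ω | N ω ≤ c * B} : ℝ) / Fintype.card Ω := by
  have hbad : #{ω | ¬ N ω ≤ c * B} * (c * B) ≤ B * Fintype.card Ω := by
    calc #{ω | ¬ N ω ≤ c * B} * (c * B) = ∑ ω with ¬ N ω ≤ c * B, c * B := by simp
      _ ≤ ∑ ω with ¬ N ω ≤ c * B, N ω := by
        refine sum_le_sum fun ω hω => ?_
        exact (not_le.mp (mem_filter.mp hω).2).le
      _ ≤ ∑ ω, N ω := sum_le_sum_of_subset_of_nonneg (filter_subset _ _) fun ω _ _ => hN ω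
      _ ≤ _ := hmean
  have hsum : (#{ω | N ω ≤ c * B} : ℝ) + #{ω | ¬ N ω ≤ c * B} = Fintype.card Ω := by
    exact_mod_cast card_filter_add_card_filter_not (s := univ) (fun ω => N ω ≤ c * B)
  have hcard : (0 : ℝ) < Fintype.card Ω := by exact_mod_cast Fintype.card_pos
  have hbad' : (#{ω | ¬ N ω ≤ c * B} : ℝ) ≤ c⁻¹ * Fintype.card Ω := by
    rw [inv_mul_eq_div, le_div_iff₀ hc]
    refine le_of_mul_le_mul_left ?_ hB
    linarith
  rw [le_div_iff₀ hcard]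
  linarith


open Classical in
/-- Lemma 1 of the paper: Let `n ≥ 2`, `r ∈ {1,…,n}`, let `P₁` and `P₂` be
partitions of `{1,…,n}` into `r` blocks each of size at most `⌈n/r⌉`, and let `C` be an
`n × n` Boolean matrix with at most `L` non-zero entries.  Fix `i, j` with `C[i,j] = 1`.
For a uniformly random independent pair of permutations `(σ, τ)`, with probability at
least `9/10` the subarray of the permuted matrix `C^{σ,τ}` containing position
`(σ i, τ j)` contains at most `10·(L⌈n/r⌉²/(n-1)² + 2⌈n/r⌉ - 1)` non-zero entries,
i.e. the number of positions `(a,b)` with `P₁ a = P₁ (σ i)`, `P₂ b = P₂ (τ j)` and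
`C[σ⁻¹ a, τ⁻¹ b] = 1` is at most this bound.  Probability is expressed as a ratio of
counts over all pairs of permutations. -/
theorem stmt_4 (n : ℕ) (hn : 2 ≤ n) (r : ℕ) (hr : 1 ≤ r) (hrn : r ≤ n)
    (P₁ P₂ : Fin n → Fin r)
    (hP₁ : ∀ t : Fin r, (Finset.univ.filter (fun x => P₁ x = t)).card ≤ ⌈(n : ℝ) / r⌉₊)
    (hP₂ : ∀ t : Fin r, (Finset.univ.filter (fun x => P₂ x = t)).card ≤ ⌈(n : ℝ) / r⌉₊)
    (L : ℕ) (C : Matrix (Fin n) (Fin n) Bool)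
    (hC : (Finset.univ.filter (fun p : Fin n × Fin n => C p.1 p.2 = true)).card ≤ L)
    (i j : Fin n) (hij : C i j = true) :
    (9 : ℝ) / 10 ≤
      ((Finset.univ.filter
          (fun p : Equiv.Perm (Fin n) × Equiv.Perm (Fin n) =>
            ((Finset.univ.filter
              (fun ab : Fin n × Fin n => P₁ ab.1 = P₁ (p.1 i) ∧ P₂ ab.2 = P₂ (p.2 j) ∧
                C (p.1⁻¹ ab.1) (p.2⁻¹ ab.2) = true)).card : ℝ)
              ≤ 10 * ((L : ℝ) * (⌈(n : ℝ) / r⌉₊ : ℝ) ^ 2 / ((n : ℝ) - 1) ^ 2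
                  + 2 * (⌈(n : ℝ) / r⌉₊ : ℝ) - 1))).card : ℝ) /
        (Fintype.card (Equiv.Perm (Fin n) × Equiv.Perm (Fin n)) : ℝ) := by
  have hn1 : (0 : ℝ) < (n : ℝ) - 1 := by
    have : (2 : ℝ) ≤ n := by exact_mod_cast hn
    linarith
  set s := ⌈(n : ℝ) / r⌉₊
  have hs1 : (1 : ℝ) ≤ s := by
    have : 0 < s := Nat.ceil_pos.mpr (by positivity)
    exact_mod_cast this
  set B : ℝ := (L : ℝ) * (s : ℝ) ^ 2 / ((n : ℝ) - 1) ^ 2 + 2 * (s : ℝ) - 1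
  have hBpos : 0 < B := by
    have : 0 ≤ (L : ℝ) * (s : ℝ) ^ 2 / ((n : ℝ) - 1) ^ 2 := by positivity
    linarith
  set F : ℝ := (Fintype.card (Equiv.Perm (Fin n)) : ℝ) with hF
  have hFpos : 0 < F := by
    rw [hF]
    exact_mod_cast Fintype.card_pos
  let A : (Fin n → Fin r) → Fin n → Fin n → ℝ := fun P a k =>
    ((Finset.univ.filter fun σ : Equiv.Perm (Fin n) => P (σ k) = P (σ a)).card : ℝ)
  let x : ℝ := ((s : ℝ) - 1) / ((n : ℝ) - 1)
  have hx : 0 ≤ x := div_nonneg (by linarith) hn1.le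
  have hA0 : ∀ P a k, 0 ≤ A P a k / F := fun P a k => by positivity
  have hAa : ∀ P a, A P a a / F ≤ 1 := fun P a => by
    rw [div_le_one hFpos]
    simp only [A, hF]
    exact_mod_cast Finset.card_le_univ _
  have hA : ∀ P : Fin n → Fin r, (∀ t, (Finset.univ.filter (fun x => P x = t)).card ≤ s) →
      ∀ a k, k ≠ a → A P a k / F ≤ x := by
    intro P hP a k hk
    have h := card_perm_same_block_le P s (fun t => by convert hP t) hk
    rw [← Nat.cast_le (α := ℝ)] at h
    simp only [Fintype.card_fin] at h
    push_cast [Nat.cast_sub (show 1 ≤ n by omega)] at h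
    have h' : ((n : ℝ) - 1) * A P a k + F ≤ s * F := by convert h
    rw [div_le_div_iff₀ hFpos hn1]
    linarith
  have hmean : ∑ p : Equiv.Perm (Fin n) × Equiv.Perm (Fin n),
      ((Finset.univ.filter
        (fun ab : Fin n × Fin n => P₁ ab.1 = P₁ (p.1 i) ∧ P₂ ab.2 = P₂ (p.2 j) ∧
          C (p.1⁻¹ ab.1) (p.2⁻¹ ab.2) = true)).card : ℝ)
      ≤ B * Fintype.card (Equiv.Perm (Fin n) × Equiv.Perm (Fin n)) := by
    set S := Finset.univ.filter (fun p : Fin n × Fin n => C p.1 p.2 = true) with hS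
    have hcount : ∀ p : Equiv.Perm (Fin n) × Equiv.Perm (Fin n),
        ((Finset.univ.filter
          (fun ab : Fin n × Fin n => P₁ ab.1 = P₁ (p.1 i) ∧ P₂ ab.2 = P₂ (p.2 j) ∧
            C (p.1⁻¹ ab.1) (p.2⁻¹ ab.2) = true)).card : ℝ)
        = ∑ e ∈ S, (if P₁ (p.1 e.1) = P₁ (p.1 i) then 1 else 0) *
            (if P₂ (p.2 e.2) = P₂ (p.2 j) then 1 else 0) := by
      intro p
      simp only [← ite_and, ite_mul, one_mul, zero_mul]
      rw [Finset.sum_boole, hS, Finset.filter_filter]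
      congr 1
      symm
      exact Finset.card_equiv (p.1.prodCongr p.2) fun e => by simp; tauto
    have hsum : ∑ p : Equiv.Perm (Fin n) × Equiv.Perm (Fin n),
        ((Finset.univ.filter
          (fun ab : Fin n × Fin n => P₁ ab.1 = P₁ (p.1 i) ∧ P₂ ab.2 = P₂ (p.2 j) ∧
            C (p.1⁻¹ ab.1) (p.2⁻¹ ab.2) = true)).card : ℝ)
        = (∑ e ∈ S, A P₁ i e.1 / F * (A P₂ j e.2 / F)) * (F * F) := by
      rw [Finset.sum_congr rfl fun p _ => hcount p, Finset.sum_comm, Finset.sum_mul]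
      refine Finset.sum_congr rfl fun e _ => ?_
      rw [sum_prod_mul (fun σ : Equiv.Perm (Fin n) => if P₁ (σ e.1) = P₁ (σ i) then (1 : ℝ) else 0)
        (fun τ : Equiv.Perm (Fin n) => if P₂ (τ e.2) = P₂ (τ j) then (1 : ℝ) else 0),
        Finset.sum_boole, Finset.sum_boole]
      simp only [A]
      field_simp
    have hbound := sum_mul_le_of_le_off_point S i j (fun k => A P₁ i k / F)
      (fun l => A P₂ j l / F) x hx (hA0 P₂ j) (hAa P₁ i) (hAa P₂ j)
      (hA P₁ hP₁ i) (hA P₂ hP₂ j)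
    have hxn : ((n : ℝ) - 1) * x = s - 1 := mul_div_cancel₀ _ hn1.ne'
    have hxs : (S.card : ℝ) * x ^ 2 ≤ (L : ℝ) * (s : ℝ) ^ 2 / ((n : ℝ) - 1) ^ 2 := by
      simp only [x]
      rw [div_pow, mul_div_assoc]
      have hSL : (S.card : ℝ) ≤ L := by exact_mod_cast hC
      gcongr
      linarith
    rw [Fintype.card_fin, hxn] at hbound
    rw [hsum, Fintype.card_prod]
    push_cast
    refine mul_le_mul_of_nonneg_right ?_ (by positivity)
    linarith
  have hmarkov := one_sub_inv_le_card_filter_div _ (fun p => Nat.cast_nonneg _)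
    (show (0 : ℝ) < 10 by norm_num) hBpos hmean
  have hnine : (9 : ℝ) / 10 = 1 - 10⁻¹ := by norm_num
  rw [hnine]
  convert hmarkov using 1
end

section
/- Let G = (I, J, E) be a bipartite undirected graph on two disjoint vertex sets I and J, each of size n, with edge set E ⊆ I × J. Let M_I ⊆ I and M_J ⊆ J be sets of marked vertices. Suppose u ∈ M_I is a marked vertex of maximum degree among the vertices of M_I, let d be the degree of u, let S ⊆ J be the set of neighbors of u, and suppose that no vertex of S belongs to M_J. Then every edge (i,j) ∈ E with i ∈ M_I and j ∈ M_J satisfies: i has degree at most d (i.e. i lies in the set I' of vertices of I of degree at most d) and j ∉ S. Moreover |I' × (J \ S)| = |I'|·(n − d) ≤ n² − |E|. -/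
/-- If every vertex of `s` has degree at most `d` in the bipartite graph `E`, then
`|s| * (n - d)` is at most the number of non-edges. -/
theorem card_mul_le_sq_sub_card {n : ℕ} (E : Finset (Fin n × Fin n)) (d : ℕ)
    (s : Finset (Fin n))
    (hs : ∀ i ∈ s, (Finset.univ.filter (fun v : Fin n => (i, v) ∈ E)).card ≤ d) :
    s.card * (n - d) ≤ n ^ 2 - E.card := by
  have hcompl : n ^ 2 - E.card =
      ∑ i : Fin n, (Finset.univ.filter (fun v : Fin n => (i, v) ∉ E)).card := by
    have h : Eᶜ.card = n ^ 2 - E.card := by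
      simp [Finset.card_compl, sq]
    have hE : Eᶜ = Finset.univ.filter (fun p : Fin n × Fin n => p ∉ E) := by
      ext p
      simp
    rw [← h, hE, Finset.card_filter, Fintype.sum_prod_type]
    simp only [Finset.card_filter]
  rw [hcompl, ← smul_eq_mul]
  refine (Finset.card_nsmul_le_sum s _ (n - d) fun i hi => ?_).trans
    (Finset.sum_le_sum_of_subset (Finset.subset_univ s))
  have hsum := Finset.card_filter_add_card_filter_not (s := (Finset.univ : Finset (Fin n)))
    (fun v => (i, v) ∈ E)
  rw [Finset.card_univ, Fintype.card_fin] at hsum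
  have := hs i hi
  omega


/-- Let `G = (I, J, E)` be a bipartite graph with `|I| = |J| = n` and
`E ⊆ I × J` (both sides indexed by `Fin n`).  Let `M_I ⊆ I`, `M_J ⊆ J` be sets of
marked vertices.  Suppose `u ∈ M_I` has maximum degree among the vertices of `M_I`,
let `d` be the degree of `u`, let `S` be the set of neighbors of `u`, and suppose no
vertex of `S` belongs to `M_J`.  Then every edge `(i,j) ∈ E` with `i ∈ M_I` and
`j ∈ M_J` satisfies: the degree of `i` is at most `d` (i.e. `i ∈ I'`, the set of
vertices of degree at most `d`) and `j ∉ S`.  Moreover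
`|I' × (J \ S)| = |I'|·(n - d) ≤ n² - |E|`. -/
theorem stmt_6 (n : ℕ) (E : Finset (Fin n × Fin n)) (MI MJ : Finset (Fin n))
    (deg : Fin n → ℕ)
    (hdeg : ∀ u : Fin n, deg u = (Finset.univ.filter (fun v : Fin n => (u, v) ∈ E)).card)
    (u : Fin n) (hu : u ∈ MI) (humax : ∀ w ∈ MI, deg w ≤ deg u)
    (d : ℕ) (hd : d = deg u)
    (S : Finset (Fin n)) (hS : S = Finset.univ.filter (fun v : Fin n => (u, v) ∈ E))
    (hSM : ∀ v ∈ S, v ∉ MJ) :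
    (∀ i j : Fin n, (i, j) ∈ E → i ∈ MI → j ∈ MJ →
      deg i ≤ d ∧ i ∈ Finset.univ.filter (fun w : Fin n => deg w ≤ d) ∧ j ∉ S) ∧
    ((Finset.univ.filter (fun w : Fin n => deg w ≤ d)) ×ˢ (Finset.univ \ S)).card
      = (Finset.univ.filter (fun w : Fin n => deg w ≤ d)).card * (n - d) ∧
    (Finset.univ.filter (fun w : Fin n => deg w ≤ d)).card * (n - d) ≤ n ^ 2 - E.card := by
  refine ⟨fun i j _ hi hj => ?_, ?_, ?_⟩
  · have hle : deg i ≤ d := hd ▸ humax i hi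
    exact ⟨hle, by simpa using hle, fun hjS => hSM j hjS hj⟩
  · have hSd : S.card = d := by rw [hS, hd, hdeg]
    rw [Finset.card_product, Finset.card_univ_sdiff, Fintype.card_fin, hSd]
  · refine card_mul_le_sq_sub_card E d _ fun i hi => ?_
    rw [← hdeg]
    exact (Finset.mem_filter.mp hi).2
end
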